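/- arXiv:2501.04482 — 4 statements merged into one kernel-verified Lean document; each statement's English description precedes it below -/
import Mathlib

section
/- For an orthoset X the following are equivalent: (a) X is atomistic; (b) for all proper x, y ∈ X, {x}⊥ ⊆ {y}⊥ implies {x}⊥ = {y}⊥; (c) for every proper x ∈ X, {x}⊥⊥ = [x] ∪ {0}, where [x] = {y ∈ X : {y}⊥ = {x}⊥}; (d) for every proper x ∈ X, the set {x}⊥⊥ is an atom of the lattice C(X) (i.e., {0} ⊊ {x}⊥⊥ and no orthoclosed set lies strictly between them). -/
/-- An orthoset (with 0). -/
structure OrthoRel (X : Type*) where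
  perp : X → X → Prop
  zero : X
  symm : ∀ x y, perp x y → perp y x
  perp_self_iff : ∀ x, perp x x ↔ x = zero
  zero_perp : ∀ x, perp zero x

/-- Orthocomplement of a set with respect to a relation. -/
def ocl {X : Type*} (p : X → X → Prop) (A : Set X) : Set X := {x | ∀ y ∈ A, p x y}

/-- A set is orthoclosed if it equals its double orthocomplement. -/
def IsOrthoclosed {X : Type*} (p : X → X → Prop) (A : Set X) : Prop :=
  A = ocl p (ocl p A)

/-- The equivalence class `[x] = {y : {y}⊥ = {x}⊥}`. -/
def eqClass {X : Type*} (O : OrthoRel X) (x : X) : Set X :=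
  {y | ocl O.perp {y} = ocl O.perp {x}}

/-- `X` is atomistic. -/
def Atomistic {X : Type*} (O : OrthoRel X) : Prop :=
  ∀ x y : X, x ≠ O.zero → y ≠ O.zero →
    (∃ z, O.perp z x ∧ ¬ O.perp z y) → ∃ z', O.perp z' y ∧ ¬ O.perp z' x

theorem mem_ocl_singleton {X : Type*} {p : X → X → Prop} {x z : X} : z ∈ ocl p {x} ↔ p z x := by
  simp [ocl]

theorem ocl_anti {X : Type*} {p : X → X → Prop} {A B : Set X} (h : A ⊆ B) :
    ocl p B ⊆ ocl p A :=
  fun _ hx y hy => hx y (h hy)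

theorem OrthoRel.subset_ocl_ocl {X : Type*} (O : OrthoRel X) (A : Set X) :
    A ⊆ ocl O.perp (ocl O.perp A) :=
  fun x hx y hy => O.symm y x (hy x hx)

theorem OrthoRel.ocl_ocl_ocl {X : Type*} (O : OrthoRel X) (A : Set X) :
    ocl O.perp (ocl O.perp (ocl O.perp A)) = ocl O.perp A :=
  (ocl_anti (O.subset_ocl_ocl A)).antisymm (O.subset_ocl_ocl _)

theorem OrthoRel.zero_mem_ocl {X : Type*} (O : OrthoRel X) (A : Set X) :
    O.zero ∈ ocl O.perp A :=
  fun y _ => O.zero_perp y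

theorem OrthoRel.mem_ocl_ocl_singleton {X : Type*} (O : OrthoRel X) {x y : X} :
    y ∈ ocl O.perp (ocl O.perp {x}) ↔ ocl O.perp {x} ⊆ ocl O.perp {y} :=
  ⟨fun h z hz => mem_ocl_singleton.2 (O.symm y z (h z hz)),
    fun h z hz => O.symm z y (mem_ocl_singleton.1 (h hz))⟩

theorem OrthoRel.self_mem_ocl_ocl_singleton {X : Type*} (O : OrthoRel X) (x : X) :
    x ∈ ocl O.perp (ocl O.perp {x}) :=
  O.subset_ocl_ocl {x} rfl

theorem OrthoRel.singleton_zero_ssubset {X : Type*} (O : OrthoRel X) {x : X} (hx : x ≠ O.zero) :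
    ({O.zero} : Set X) ⊂ ocl O.perp (ocl O.perp {x}) :=
  ⟨Set.singleton_subset_iff.2 (O.zero_mem_ocl _),
    fun h => hx (h (O.self_mem_ocl_ocl_singleton x))⟩

theorem atomistic_iff_ocl_eq_of_subset {X : Type*} (O : OrthoRel X) :
    Atomistic O ↔
      ∀ x y : X, x ≠ O.zero → y ≠ O.zero →
        ocl O.perp {x} ⊆ ocl O.perp {y} → ocl O.perp {x} = ocl O.perp {y} := by
  constructor
  · intro h x y hx hy hxy
    refine hxy.antisymm fun z hz => ?_
    rw [mem_ocl_singleton] at hz ⊢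
    by_contra hzx
    obtain ⟨w, hwx, hwy⟩ := h y x hy hx ⟨z, hz, hzx⟩
    exact hwy (mem_ocl_singleton.1 (hxy (mem_ocl_singleton.2 hwx)))
  · rintro h x y hx hy ⟨z, hzx, hzy⟩
    by_contra! hyx
    have heq := h y x hy hx fun w hw => mem_ocl_singleton.2 (hyx w (mem_ocl_singleton.1 hw))
    exact hzy (mem_ocl_singleton.1 (heq ▸ mem_ocl_singleton.2 hzx))

theorem atomistic_iff_ocl_ocl_singleton_eq {X : Type*} (O : OrthoRel X) :
    Atomistic O ↔
      ∀ x : X, x ≠ O.zero →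
        ocl O.perp (ocl O.perp {x}) = eqClass O x ∪ {O.zero} := by
  rw [atomistic_iff_ocl_eq_of_subset]
  constructor
  · intro h x hx
    ext y
    constructor
    · intro hy
      by_cases hy0 : y = O.zero
      · exact Or.inr hy0
      · exact Or.inl (h x y hx hy0 (O.mem_ocl_ocl_singleton.1 hy)).symm
    · rintro (hy | rfl)
      · exact O.mem_ocl_ocl_singleton.2 hy.symm.subset
      · exact O.zero_mem_ocl _
  · intro h x y hx hy hxy
    have hmem := O.mem_ocl_ocl_singleton.2 hxy
    rw [h x hx] at hmem
    exact (hmem.resolve_right hy).symm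

theorem atomistic_iff_ocl_ocl_singleton_isAtom {X : Type*} (O : OrthoRel X) :
    Atomistic O ↔
      ∀ x : X, x ≠ O.zero →
        ({O.zero} : Set X) ⊂ ocl O.perp (ocl O.perp {x}) ∧
        ¬ ∃ B : Set X, IsOrthoclosed O.perp B ∧ ({O.zero} : Set X) ⊂ B ∧
          B ⊂ ocl O.perp (ocl O.perp {x}) := by
  rw [atomistic_iff_ocl_eq_of_subset]
  constructor
  · intro h x hx
    refine ⟨O.singleton_zero_ssubset hx, ?_⟩
    rintro ⟨B, hB, h0B, hBx⟩
    obtain ⟨y, hyB, hy⟩ := Set.exists_of_ssubset h0B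
    have hxy := h x y hx hy (O.mem_ocl_ocl_singleton.1 (hBx.subset hyB))
    refine hBx.not_subset ?_
    rw [hxy, hB]
    exact ocl_anti (ocl_anti (Set.singleton_subset_iff.2 hyB))
  · intro h x y hx hy hxy
    have heq : ocl O.perp (ocl O.perp {y}) = ocl O.perp (ocl O.perp {x}) := by
      by_contra hne
      exact (h x hx).2 ⟨_, (O.ocl_ocl_ocl _).symm, O.singleton_zero_ssubset hy,
        (ocl_anti hxy).ssubset_of_ne hne⟩
    rw [← O.ocl_ocl_ocl {x}, ← heq, O.ocl_ocl_ocl]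

/-- Lemma 2.7: characterisations of atomisticity: (b) among proper elements,
inclusion of orthocomplements implies their equality; (c) `{x}⊥⊥ = [x] ∪ {0}` for
proper `x`; (d) `{x}⊥⊥` is an atom of `C(X)` for every proper `x`. -/
theorem stmt3 {X : Type*} (O : OrthoRel X) :
    (Atomistic O ↔
      ∀ x y : X, x ≠ O.zero → y ≠ O.zero →
        ocl O.perp {x} ⊆ ocl O.perp {y} → ocl O.perp {x} = ocl O.perp {y}) ∧
    (Atomistic O ↔
      ∀ x : X, x ≠ O.zero →
        ocl O.perp (ocl O.perp {x}) = eqClass O x ∪ {O.zero}) ∧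
    (Atomistic O ↔
      ∀ x : X, x ≠ O.zero →
        ({O.zero} : Set X) ⊂ ocl O.perp (ocl O.perp {x}) ∧
        ¬ ∃ B : Set X, IsOrthoclosed O.perp B ∧ ({O.zero} : Set X) ⊂ B ∧
          B ⊂ ocl O.perp (ocl O.perp {x})) := ⟨atomistic_iff_ocl_eq_of_subset O, atomistic_iff_ocl_ocl_singleton_eq O,
    atomistic_iff_ocl_ocl_singleton_isAtom O⟩
end

section
/- For an orthoset X the following are equivalent: (a) the ortholattice C(X) is orthomodular, i.e., for all orthoclosed A ⊆ B one has B = (A ∪ (B ∩ A⊥))⊥⊥; (b) for every orthoclosed A ⊆ X and every B ⊆ A, (B⊥ ∩ A)⊥ ∩ A = B⊥⊥; (c) for every orthoclosed A ⊆ X, the orthoclosed subsets of the orthoset A (with the restricted relation) are exactly the orthoclosed subsets of X contained in A; (d) for every orthoclosed A ⊆ X and every maximal ⊥-set D contained in A, one has A = D⊥⊥. -/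
/-- `C(X)` is orthomodular: for orthoclosed `A ⊆ B`, `B = A ∨ (B ∩ A⊥)`. -/
def Orthomodular {X : Type*} (O : OrthoRel X) : Prop :=
  ∀ A B : Set X, IsOrthoclosed O.perp A → IsOrthoclosed O.perp B → A ⊆ B →
    B = ocl O.perp (ocl O.perp (A ∪ (B ∩ ocl O.perp A)))

/-- A `⊥`-set: a set of mutually orthogonal proper elements. -/
def PerpSet {X : Type*} (O : OrthoRel X) (D : Set X) : Prop :=
  (∀ x ∈ D, x ≠ O.zero) ∧ ∀ x ∈ D, ∀ y ∈ D, x ≠ y → O.perp x y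

namespace OrthoRel

variable {X : Type*} (O : OrthoRel X)

theorem ocl_anti {A B : Set X} (h : A ⊆ B) : ocl O.perp B ⊆ ocl O.perp A :=
  fun _ hx y hy => hx y (h hy)

theorem subset_ocl_ocl_s7 (A : Set X) : A ⊆ ocl O.perp (ocl O.perp A) :=
  fun x hx y hy => O.symm y x (hy x hx)

theorem ocl_ocl_ocl_s7 (A : Set X) : ocl O.perp (ocl O.perp (ocl O.perp A)) = ocl O.perp A :=
  (O.ocl_anti (O.subset_ocl_ocl_s7 A)).antisymm (O.subset_ocl_ocl_s7 _)

theorem isOrthoclosed_ocl (A : Set X) : IsOrthoclosed O.perp (ocl O.perp A) :=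
  (O.ocl_ocl_ocl_s7 A).symm

theorem ocl_union (A B : Set X) :
    ocl O.perp (A ∪ B) = ocl O.perp A ∩ ocl O.perp B := by
  ext x
  exact ⟨fun h => ⟨fun y hy => h y (Or.inl hy), fun y hy => h y (Or.inr hy)⟩,
    fun h y hy => hy.elim (h.1 y) (h.2 y)⟩

variable {O}

theorem ocl_ocl_subset {A B : Set X} (hA : IsOrthoclosed O.perp A) (h : B ⊆ A) :
    ocl O.perp (ocl O.perp B) ⊆ A :=
  (O.ocl_anti (O.ocl_anti h)).trans hA.symm.subset

/-- Every `⊥`-set in `A` extends to a maximal one. -/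
theorem exists_maximal_perpSet {A D : Set X} (hD : PerpSet O D) (hDA : D ⊆ A) :
    ∃ M, D ⊆ M ∧ PerpSet O M ∧ M ⊆ A ∧
      ∀ E : Set X, PerpSet O E → E ⊆ A → M ⊆ E → E = M := by
  obtain ⟨M, hDM, hM⟩ := zorn_subset_nonempty {E : Set X | PerpSet O E ∧ E ⊆ A}
    (by
      intro c hc hchain _
      refine ⟨⋃₀ c, ⟨⟨?_, ?_⟩, Set.sUnion_subset fun E hE => (hc hE).2⟩,
        fun E hE => Set.subset_sUnion_of_mem hE⟩
      · rintro x ⟨E, hE, hx⟩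
        exact (hc hE).1.1 x hx
      · rintro x ⟨E, hE, hx⟩ y ⟨F, hF, hy⟩ hxy
        rcases hchain.total hE hF with h | h
        · exact (hc hF).1.2 x (h hx) y hy hxy
        · exact (hc hE).1.2 x hx y (h hy) hxy)
    D ⟨hD, hDA⟩
  exact ⟨M, hDM, hM.prop.1, hM.prop.2, fun E hE hEA hME =>
    (hM.eq_of_subset ⟨hE, hEA⟩ hME).symm⟩

/-- Only zero is orthogonal to a maximal `⊥`-set of `A` and in `A`. -/
theorem eq_zero_of_mem_ocl_of_maximal {A D : Set X} (hD : PerpSet O D) (hDA : D ⊆ A)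
    (hmax : ∀ E : Set X, PerpSet O E → E ⊆ A → D ⊆ E → E = D)
    {x : X} (hxA : x ∈ A) (hx : x ∈ ocl O.perp D) : x = O.zero := by
  by_contra hx0
  have hE : insert x D = D := by
    refine hmax _ ⟨?_, ?_⟩ (Set.insert_subset hxA hDA) (Set.subset_insert x D)
    · rintro y (rfl | hy)
      exacts [hx0, hD.1 y hy]
    · rintro y (rfl | hy) z (rfl | hz) hyz
      exacts [absurd rfl hyz, hx z hz, O.symm _ _ (hx y hy), hD.2 y hy z hz hyz]
  exact hx0 ((O.perp_self_iff x).1 (hx x (hE ▸ Set.mem_insert x D)))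

theorem orthomodular_iff_relative_ocl_ocl :
    Orthomodular O ↔
      ∀ A B : Set X, IsOrthoclosed O.perp A → B ⊆ A →
        ocl O.perp (ocl O.perp B ∩ A) ∩ A = ocl O.perp (ocl O.perp B) := by
  constructor
  · intro h A B hA hBA
    have h1 := h _ _ (O.isOrthoclosed_ocl A) (O.isOrthoclosed_ocl B) (O.ocl_anti hBA)
    rw [← hA] at h1
    have h2 := congrArg (ocl O.perp) h1
    rw [O.ocl_ocl_ocl_s7, O.ocl_union, ← hA, Set.inter_comm] at h2
    exact h2.symm
  · intro h A B hA hB hAB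
    have h1 := h _ _ (O.isOrthoclosed_ocl A) (O.ocl_anti hAB)
    rw [← hB, Set.inter_comm, ← O.ocl_union] at h1
    rw [h1, ← hB]

theorem orthomodular_iff_relative_orthoclosed :
    Orthomodular O ↔
      ∀ A : Set X, IsOrthoclosed O.perp A → ∀ B : Set X,
        ((B ⊆ A ∧ B = ocl O.perp (ocl O.perp B ∩ A) ∩ A) ↔
          (IsOrthoclosed O.perp B ∧ B ⊆ A)) := by
  rw [orthomodular_iff_relative_ocl_ocl]
  constructor
  · intro h A hA B
    constructor
    · rintro ⟨hBA, hB⟩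
      exact ⟨hB.trans (h A B hA hBA), hBA⟩
    · rintro ⟨hB, hBA⟩
      exact ⟨hBA, Eq.trans hB (h A B hA hBA).symm⟩
  · intro h A B hA hBA
    have h1 := ((h A hA _).2 ⟨O.isOrthoclosed_ocl (ocl O.perp B), ocl_ocl_subset hA hBA⟩).2
    rw [O.ocl_ocl_ocl_s7] at h1
    exact h1.symm

/-- Dacey's criterion. -/
theorem orthomodular_iff_maximal_perpSet :
    Orthomodular O ↔
      ∀ A D : Set X, IsOrthoclosed O.perp A → PerpSet O D → D ⊆ A →
        (∀ E : Set X, PerpSet O E → E ⊆ A → D ⊆ E → E = D) →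
        A = ocl O.perp (ocl O.perp D) := by
  constructor
  · intro h A D hA hD hDA hmax
    have h1 := h _ A (O.isOrthoclosed_ocl (ocl O.perp D)) hA (ocl_ocl_subset hA hDA)
    rw [O.ocl_ocl_ocl_s7, Set.union_eq_self_of_subset_right, O.ocl_ocl_ocl_s7] at h1
    · exact h1
    · rintro x ⟨hxA, hx⟩
      rw [eq_zero_of_mem_ocl_of_maximal hD hDA hmax hxA hx]
      exact fun y _ => O.zero_perp y
  · intro h A B hA hB hAB
    obtain ⟨D, -, hD, hDA, hDmax⟩ :=
      exists_maximal_perpSet (O := O) (A := A) (D := ∅) ⟨by simp, by simp⟩ (by simp)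
    obtain ⟨M, hDM, hM, hMB, hMmax⟩ := exists_maximal_perpSet hD (hDA.trans hAB)
    have hAD := h A D hA hD hDA hDmax
    have hBM := h B M hB hM hMB hMmax
    have hsub : M ⊆ A ∪ (B ∩ ocl O.perp A) := by
      intro x hx
      by_cases hxD : x ∈ D
      · exact Or.inl (hDA hxD)
      · refine Or.inr ⟨hMB hx, ?_⟩
        rw [hAD, O.ocl_ocl_ocl_s7]
        exact fun y hy => hM.2 x hx y (hDM hy) (fun hxy => hxD (hxy ▸ hy))
    refine Set.Subset.antisymm ?_
      (ocl_ocl_subset hB (Set.union_subset hAB Set.inter_subset_left))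
    exact hBM.subset.trans (O.ocl_anti (O.ocl_anti hsub))

end OrthoRel

/-- Lemma 2.12: characterisations of Dacey spaces: (a) `C(X)` is orthomodular;
(b) for orthoclosed `A` and any `B ⊆ A`, the double orthocomplement of `B` inside
the suborthoset `A` equals `B⊥⊥`; (c) the orthoclosed subsets of the suborthoset
`A` are exactly the orthoclosed subsets of `X` contained in `A`; (d) Dacey's
criterion via maximal `⊥`-sets. -/
theorem stmt7 {X : Type*} (O : OrthoRel X) :
    (Orthomodular O ↔
      ∀ A B : Set X, IsOrthoclosed O.perp A → B ⊆ A →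
        ocl O.perp (ocl O.perp B ∩ A) ∩ A = ocl O.perp (ocl O.perp B)) ∧
    (Orthomodular O ↔
      ∀ A : Set X, IsOrthoclosed O.perp A → ∀ B : Set X,
        ((B ⊆ A ∧ B = ocl O.perp (ocl O.perp B ∩ A) ∩ A) ↔
          (IsOrthoclosed O.perp B ∧ B ⊆ A))) ∧
    (Orthomodular O ↔
      ∀ A D : Set X, IsOrthoclosed O.perp A → PerpSet O D → D ⊆ A →
        (∀ E : Set X, PerpSet O E → E ⊆ A → D ⊆ E → E = D) →
        A = ocl O.perp (ocl O.perp D)) := by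
  exact ⟨OrthoRel.orthomodular_iff_relative_ocl_ocl,
    OrthoRel.orthomodular_iff_relative_orthoclosed, OrthoRel.orthomodular_iff_maximal_perpSet⟩
end

section
/- Let f : X → Y and g : Y → X be an adjoint pair of maps between orthosets, and define C(f) : C(X) → C(Y), A ↦ f(A)⊥⊥, and C(g) : C(Y) → C(X), B ↦ g(B)⊥⊥. Then: (i) for all orthoclosed A ⊆ X and B ⊆ Y, C(f)(A) ⊆ B⊥ if and only if A ⊆ C(g)(B)⊥; (ii) C(f) preserves arbitrary joins: for any family (Aᵢ) of orthoclosed subsets of X, f((⋃ᵢ Aᵢ)⊥⊥)⊥⊥ = (⋃ᵢ f(Aᵢ)⊥⊥)⊥⊥; (iii) for all orthoclosed A ⊆ X and B ⊆ Y, f(A)⊥⊥ ⊆ B if and only if A ⊆ g(B⊥)⊥. -/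
/-- `g` is an adjoint of `f`: `f(x) ⊥ y` iff `x ⊥ g(y)`. -/
def IsAdjointPair {X Y : Type*} (pX : X → X → Prop) (pY : Y → Y → Prop)
    (f : X → Y) (g : Y → X) : Prop :=
  ∀ x y, pY (f x) y ↔ pX x (g y)

section Orthocomplement

variable {X Y : Type*} {p : X → X → Prop} {q : Y → Y → Prop}

theorem subset_ocl_comm (hp : ∀ x y, p x y → p y x) {A B : Set X} :
    A ⊆ ocl p B ↔ B ⊆ ocl p A :=
  ⟨fun h y hy x hx => hp x y (h hx y hy), fun h x hx y hy => hp y x (h hy x hx)⟩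

theorem subset_ocl_ocl (hp : ∀ x y, p x y → p y x) (A : Set X) : A ⊆ ocl p (ocl p A) :=
  (subset_ocl_comm hp).1 subset_rfl

theorem ocl_antitone (p : X → X → Prop) : Antitone (ocl p) :=
  fun _ _ h _ hx y hy => hx y (h hy)

theorem ocl_ocl_ocl (hp : ∀ x y, p x y → p y x) (A : Set X) :
    ocl p (ocl p (ocl p A)) = ocl p A :=
  (ocl_antitone p (subset_ocl_ocl hp A)).antisymm (subset_ocl_ocl hp _)

theorem ocl_ocl_subset_ocl_iff (hp : ∀ x y, p x y → p y x) {A B : Set X} :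
    ocl p (ocl p A) ⊆ ocl p B ↔ A ⊆ ocl p B := by
  rw [subset_ocl_comm hp, ocl_ocl_ocl hp, subset_ocl_comm hp]

theorem ocl_iUnion {ι : Sort*} (p : X → X → Prop) (A : ι → Set X) :
    ocl p (⋃ i, A i) = ⋂ i, ocl p (A i) := by
  ext x
  simp only [ocl, Set.mem_iUnion, Set.mem_iInter, Set.mem_ofPred_eq]
  exact ⟨fun h i y hy => h y ⟨i, hy⟩, fun h y ⟨i, hy⟩ => h i y hy⟩

theorem IsAdjointPair.image_subset_ocl_iff {f : X → Y} {g : Y → X}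
    (hadj : IsAdjointPair p q f g) {A : Set X} {B : Set Y} :
    f '' A ⊆ ocl q B ↔ A ⊆ ocl p (g '' B) := by
  rw [Set.image_subset_iff]
  refine forall₂_congr fun x _ => ?_
  simp only [Set.mem_preimage, ocl, Set.mem_ofPred_eq, Set.forall_mem_image, hadj x]

theorem IsAdjointPair.ocl_image {f : X → Y} {g : Y → X} (hadj : IsAdjointPair p q f g)
    (hp : ∀ x y, p x y → p y x) (hq : ∀ x y, q x y → q y x) (A : Set X) :
    ocl q (f '' A) = g ⁻¹' ocl p A := by
  ext y
  simp only [Set.mem_preimage, ocl, Set.mem_ofPred_eq, Set.forall_mem_image]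
  exact forall₂_congr fun x _ =>
    ⟨fun h => hp _ _ ((hadj x y).1 (hq _ _ h)), fun h => hq _ _ ((hadj x y).2 (hp _ _ h))⟩

end Orthocomplement

/-- Lemma 3.7: for an adjoint pair `f`, `g`, the induced maps
`C(f) : A ↦ f(A)⊥⊥` and `C(g) : B ↦ g(B)⊥⊥` form an adjoint pair between `C(X)`
and `C(Y)`; `C(f)` is sup-preserving; and `f(A)⊥⊥ ⊆ B` iff `A ⊆ g(B⊥)⊥`. -/
theorem stmt12 {X Y : Type*} (OX : OrthoRel X) (OY : OrthoRel Y)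
    (f : X → Y) (g : Y → X) (hadj : IsAdjointPair OX.perp OY.perp f g) :
    -- (i) C(f) and C(g) are an adjoint pair
    (∀ A : Set X, ∀ B : Set Y, IsOrthoclosed OX.perp A → IsOrthoclosed OY.perp B →
      (ocl OY.perp (ocl OY.perp (f '' A)) ⊆ ocl OY.perp B ↔
        A ⊆ ocl OX.perp (ocl OX.perp (ocl OX.perp (g '' B))))) ∧
    -- (ii) C(f) preserves arbitrary joins
    (∀ {ι : Type*} (A : ι → Set X), (∀ i, IsOrthoclosed OX.perp (A i)) →
      ocl OY.perp (ocl OY.perp (f '' ocl OX.perp (ocl OX.perp (⋃ i, A i)))) =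
        ocl OY.perp (ocl OY.perp (⋃ i, ocl OY.perp (ocl OY.perp (f '' A i))))) ∧
    -- (iii)
    (∀ A : Set X, ∀ B : Set Y, IsOrthoclosed OX.perp A → IsOrthoclosed OY.perp B →
      (ocl OY.perp (ocl OY.perp (f '' A)) ⊆ B ↔
        A ⊆ ocl OX.perp (g '' ocl OY.perp B))) := by
  have hX := OX.symm
  have hY := OY.symm
  refine ⟨fun A B _ _ => ?_, fun A _ => ?_, fun A B _ hB => ?_⟩
  · rw [ocl_ocl_subset_ocl_iff hY, ocl_ocl_ocl hX, hadj.image_subset_ocl_iff]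
  · congr 1
    rw [hadj.ocl_image hX hY, ocl_ocl_ocl hX, ocl_iUnion, ocl_iUnion, Set.preimage_iInter]
    exact Set.iInter_congr fun i => by rw [ocl_ocl_ocl hY, hadj.ocl_image hX hY]
  · rw [← hadj.image_subset_ocl_iff, ← ocl_ocl_subset_ocl_iff hY, ← hB]
end

section
/- For a map f : X → Y between orthosets, the following are equivalent: (a) f is an orthoisomorphism; (b) f is bijective and f⁻¹ is an adjoint of f; (c) f is bijective and possesses an adjoint g : Y → X such that g ∘ f ∥ id_X; (d) f is bijective and adjointable, and g ∘ f ∥ id_X for every adjoint g of f. -/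
/-- An orthoisomorphism: a bijection sending `0` to `0` which preserves and
reflects the orthogonality relation. -/
def OrthoIso {X Y : Type*} (OX : OrthoRel X) (OY : OrthoRel Y) (f : X → Y) : Prop :=
  Function.Bijective f ∧ f OX.zero = OY.zero ∧
    ∀ x y : X, OX.perp x y ↔ OY.perp (f x) (f y)

theorem orthoIso_of_preserves {X Y : Type*} (OX : OrthoRel X) (OY : OrthoRel Y) {f : X → Y}
    (hf : Function.Bijective f) (h : ∀ x y, OX.perp x y ↔ OY.perp (f x) (f y)) :
    OrthoIso OX OY f :=
  ⟨hf, (OY.perp_self_iff _).1 ((h _ _).1 (OX.zero_perp _)), h⟩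

theorem ocl_singleton_eq_iff {X : Type*} (p : X → X → Prop) (a b : X) :
    ocl p {a} = ocl p {b} ↔ ∀ x, p x a ↔ p x b := by
  simp [ocl, Set.ext_iff]

theorem OrthoIso.exists_inverse_adjoint {X Y : Type*} {OX : OrthoRel X} {OY : OrthoRel Y}
    {f : X → Y} (h : OrthoIso OX OY f) :
    ∃ finv : Y → X, Function.LeftInverse finv f ∧ Function.RightInverse finv f ∧
      IsAdjointPair OX.perp OY.perp f finv := by
  obtain ⟨g, hl, hr⟩ := Function.bijective_iff_has_inverse.1 h.1
  exact ⟨g, hl, hr, fun x y => by rw [h.2.2, hr y]⟩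

theorem OrthoIso.ocl_adjoint_comp {X Y : Type*} {OX : OrthoRel X} {OY : OrthoRel Y}
    {f : X → Y} (h : OrthoIso OX OY f) {g : Y → X}
    (hg : IsAdjointPair OX.perp OY.perp f g) (x : X) :
    ocl OX.perp {g (f x)} = ocl OX.perp {x} :=
  (ocl_singleton_eq_iff _ _ _).2 fun z => (hg z (f x)).symm.trans (h.2.2 z x).symm

theorem orthoIso_of_adjoint {X Y : Type*} {OX : OrthoRel X} {OY : OrthoRel Y}
    {f : X → Y} (hf : Function.Bijective f) {g : Y → X}
    (hg : IsAdjointPair OX.perp OY.perp f g)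
    (h : ∀ x, ocl OX.perp {g (f x)} = ocl OX.perp {x}) : OrthoIso OX OY f :=
  orthoIso_of_preserves OX OY hf fun x y =>
    ((ocl_singleton_eq_iff _ _ _).1 (h y) x).symm.trans (hg x (f y)).symm

/-- Proposition 4.2: `f` is an orthoisomorphism iff `f` is bijective with `f⁻¹`
an adjoint, iff `f` is bijective with some adjoint `g` with `g ∘ f ∥ id`, iff `f`
is bijective, adjointable, and `g ∘ f ∥ id` for every adjoint `g` of `f`. -/
theorem stmt16 {X Y : Type*} (OX : OrthoRel X) (OY : OrthoRel Y) (f : X → Y) :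
    (OrthoIso OX OY f ↔
      (Function.Bijective f ∧
        ∃ finv : Y → X, Function.LeftInverse finv f ∧ Function.RightInverse finv f ∧
          IsAdjointPair OX.perp OY.perp f finv)) ∧
    (OrthoIso OX OY f ↔
      (Function.Bijective f ∧
        ∃ g : Y → X, IsAdjointPair OX.perp OY.perp f g ∧
          ∀ x : X, ocl OX.perp {g (f x)} = ocl OX.perp {x})) ∧
    (OrthoIso OX OY f ↔
      (Function.Bijective f ∧ (∃ g : Y → X, IsAdjointPair OX.perp OY.perp f g) ∧
        ∀ g : Y → X, IsAdjointPair OX.perp OY.perp f g →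
          ∀ x : X, ocl OX.perp {g (f x)} = ocl OX.perp {x})) := by
  refine ⟨⟨fun h => ⟨h.1, h.exists_inverse_adjoint⟩, ?_⟩, ⟨fun h => ?_, ?_⟩, ⟨fun h => ?_, ?_⟩⟩
  · rintro ⟨hf, g, hl, -, hg⟩
    exact orthoIso_of_adjoint hf hg fun x => by rw [hl x]
  · obtain ⟨g, -, -, hg⟩ := h.exists_inverse_adjoint
    exact ⟨h.1, g, hg, h.ocl_adjoint_comp hg⟩
  · rintro ⟨hf, g, hg, h⟩
    exact orthoIso_of_adjoint hf hg h
  · obtain ⟨g, -, -, hg⟩ := h.exists_inverse_adjoint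
    exact ⟨h.1, ⟨g, hg⟩, fun _ hg' => h.ocl_adjoint_comp hg'⟩
  · rintro ⟨hf, ⟨g, hg⟩, h⟩
    exact orthoIso_of_adjoint hf hg (h g hg)
end
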